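/- Let d ≥ 6 and suppose φ(x,t) = ∑_n f_n(t) C_n^{(d-1)/2}(x) with f_n ∈ P(ℝ^k), ∑_n f_n(0) C_n^{(d-1)/2}(1) < ∞, and f_{2n+1} ≡ 0 for all n. Then I₁²φ(x,t) := ∫_{-1}^x ∫_{-1}^u φ(w,t) dw du has Gegenbauer expansion ∑_n g_n(t) C_n^{(d-5)/2}(x) where all coefficient functions g_n belong to P(ℝ^k), and hence I₁²φ ∈ P(𝕊^{d-4} × ℝ^k). -/

import Mathlib

open MeasureTheory Filter

noncomputable section

/-- Gegenbauer (ultraspherical) polynomial `C_n^lam`, defined via the standard recurrence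
equivalent to the generating function `(1 - 2xt + t²)^{-lam} = ∑ C_n^lam(x) t^n`. -/
def gegenbauer (lam : ℝ) : ℕ → ℝ → ℝ
  | 0 => fun _ => 1
  | 1 => fun x => 2 * lam * x
  | (n + 2) => fun x =>
      (2 * x * ((n : ℝ) + 1 + lam) * gegenbauer lam (n + 1) x
        - ((n : ℝ) + 2 * lam) * gegenbauer lam n x) / ((n : ℝ) + 2)

/-- Positive definiteness of a real kernel on a set `X`. -/
def IsPosDefKernel {X : Type*} (C : X → X → ℝ) : Prop :=
  ∀ (N : ℕ) (x : Fin N → X) (a : Fin N → ℝ),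
    0 ≤ ∑ i, ∑ j, a i * C (x i) (x j) * a j

/-- The class `P(ℝ^k)`: continuous `f : [0,∞) → ℝ` whose radial extension
`(x,y) ↦ f (dist x y)` is positive definite on `ℝ^k`. -/
def radPD (k : ℕ) (f : ℝ → ℝ) : Prop :=
  ContinuousOn f (Set.Ici 0) ∧
  IsPosDefKernel (fun x y : EuclideanSpace ℝ (Fin k) => f (dist x y))

/-- The class `P(𝕊^d × ℝ^k)` via the Berg–Porcu characterization: `φ` has a Gegenbauer
expansion `φ(x,t) = ∑ f_n(t) C_n^{(d-1)/2}(x)` with `f_n ∈ P(ℝ^k)` and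
`∑ f_n(0) C_n^{(d-1)/2}(1) < ∞`. -/
def memPSphereRk (d k : ℕ) (φ : ℝ → ℝ → ℝ) : Prop :=
  ∃ f : ℕ → ℝ → ℝ,
    (∀ n, radPD k (f n)) ∧
    Summable (fun n => f n 0 * gegenbauer (((d : ℝ) - 1) / 2) n 1) ∧
    ∀ x ∈ Set.Icc (-1 : ℝ) 1, ∀ t, 0 ≤ t →
      φ x t = ∑' n, f n t * gegenbauer (((d : ℝ) - 1) / 2) n x

section Helpers

lemma geg_rec (lam : ℝ) (n : ℕ) (x : ℝ) :
    ((n : ℝ) + 2) * gegenbauer lam (n + 2) x =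
      2 * x * ((n : ℝ) + 1 + lam) * gegenbauer lam (n + 1) x
        - ((n : ℝ) + 2 * lam) * gegenbauer lam n x := by
  have : (n : ℝ) + 2 ≠ 0 := by positivity
  rw [gegenbauer]
  field_simp

lemma geg_zero (lam x : ℝ) : gegenbauer lam 0 x = 1 := by simp [gegenbauer]

lemma geg_one (lam x : ℝ) : gegenbauer lam 1 x = 2 * lam * x := by simp [gegenbauer]

lemma geg_neg (lam : ℝ) (n : ℕ) (x : ℝ) :
    gegenbauer lam n (-x) = (-1) ^ n * gegenbauer lam n x := by
  induction n using Nat.twoStepInduction with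
  | zero => simp [geg_zero]
  | one => simp [geg_one]
  | more n h0 h1 =>
    have h2 : (n : ℝ) + 2 ≠ 0 := by positivity
    apply mul_left_cancel₀ h2
    rw [geg_rec, h0, h1]
    linear_combination -(-1) ^ n * geg_rec lam n x

/-- `(n+2) C_{n+2}^ν = 2ν (x C_{n+1}^{ν+1} - C_n^{ν+1})`. -/
lemma geg_relA (nu : ℝ) (n : ℕ) (x : ℝ) :
    ((n : ℝ) + 2) * gegenbauer nu (n + 2) x =
      2 * nu * (x * gegenbauer (nu + 1) (n + 1) x - gegenbauer (nu + 1) n x) := by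
  induction n using Nat.twoStepInduction with
  | zero =>
    rw [geg_rec]
    simp only [zero_add, geg_one, geg_zero]
    push_cast; ring
  | one =>
    rw [geg_rec]
    have h1 := geg_rec nu 0 x
    have h2 := geg_rec (nu + 1) 0 x
    simp only [zero_add, geg_one, geg_zero, Nat.cast_zero] at h1 h2
    simp only [Nat.reduceAdd, Nat.cast_one, geg_one] at *
    linear_combination (2 * x * (2 + nu)) / 2 * h1 - nu * x * h2
  | more n h0 h1 =>
    rw [geg_rec]
    have r1 := geg_rec (nu + 1) n x
    have r2 := geg_rec (nu + 1) (n + 1) x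
    push_cast at *
    have e0 : (n : ℝ) + 2 ≠ 0 := by positivity
    have e1 : (n : ℝ) + 1 + 2 ≠ 0 := by positivity
    -- relation B at n and n+1
    have b0 : ((n : ℝ) + 2 + nu) * gegenbauer nu (n + 2) x
        = nu * (gegenbauer (nu + 1) (n + 2) x - gegenbauer (nu + 1) n x) := by
      apply mul_left_cancel₀ e0
      linear_combination (n + 2 + nu) * h0 - nu * r1
    have b1 : ((n : ℝ) + 3 + nu) * gegenbauer nu (n + 1 + 2) x
        = nu * (gegenbauer (nu + 1) (n + 1 + 2) x - gegenbauer (nu + 1) (n + 1) x) := by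
      apply mul_left_cancel₀ e1
      linear_combination (n + 3 + nu) * h1 - nu * r2
    have k1 : n + 2 + 1 = n + 1 + 2 := by ring
    rw [k1]
    linear_combination 2 * x * b1 - 2 * b0 + h0

lemma geg_relB (nu : ℝ) (n : ℕ) (x : ℝ) :
    ((n : ℝ) + 2 + nu) * gegenbauer nu (n + 2) x
        = nu * (gegenbauer (nu + 1) (n + 2) x - gegenbauer (nu + 1) n x) := by
  have e0 : (n : ℝ) + 2 ≠ 0 := by positivity
  apply mul_left_cancel₀ e0
  linear_combination (n + 2 + nu) * geg_relA nu n x - nu * geg_rec (nu + 1) n x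

lemma geg_deriv (nu : ℝ) (n : ℕ) (x : ℝ) :
    HasDerivAt (gegenbauer nu (n + 1)) (2 * nu * gegenbauer (nu + 1) n x) x := by
  induction n using Nat.twoStepInduction with
  | zero =>
    have : gegenbauer nu (0 + 1) = fun x => 2 * nu * x := by ext y; exact geg_one nu y
    rw [this, geg_zero]
    exact (hasDerivAt_id x).const_mul (2 * nu)
  | one =>
    have : gegenbauer nu (1 + 1) = fun x => (2 * x * (1 + nu) * (2 * nu * x) - 2 * nu) / 2 := by
      ext y
      have := geg_rec nu 0 y
      simp only [zero_add, geg_one, geg_zero, Nat.cast_zero] at this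
      simp only [Nat.reduceAdd]
      linear_combination this / 2
    rw [this, geg_one]
    have h := (((((hasDerivAt_id x).const_mul 2).mul_const (1 + nu)).mul
      ((hasDerivAt_id x).const_mul (2 * nu))).sub_const (2 * nu)).div_const 2
    refine h.congr_deriv ?_
    simp only [id]
    ring
  | more n h0 h1 =>
    have : gegenbauer nu (n + 2 + 1) = fun x =>
        (2 * x * (((n + 1 : ℕ) : ℝ) + 1 + nu) * gegenbauer nu (n + 1 + 1) x
        - (((n + 1 : ℕ) : ℝ) + 2 * nu) * gegenbauer nu (n + 1) x) / (((n + 1 : ℕ) : ℝ) + 2) := by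
      rw [show n + 2 + 1 = (n + 1) + 2 by ring, gegenbauer]
    rw [this]
    have h := (((((hasDerivAt_id x).const_mul 2).mul_const (((n + 1 : ℕ) : ℝ) + 1 + nu)).mul
      h1).sub (h0.const_mul (((n + 1 : ℕ) : ℝ) + 2 * nu))).div_const (((n + 1 : ℕ) : ℝ) + 2)
    refine h.congr_deriv ?_
    have e : (((n + 1 : ℕ) : ℝ) + 2) ≠ 0 := by positivity
    rw [div_eq_iff e]
    simp only [id]
    push_cast
    have b := geg_relB nu n x
    have r := geg_rec (nu + 1) n x
    linear_combination 2 * b - 2 * nu * r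

lemma geg_cont (nu : ℝ) (n : ℕ) : Continuous (gegenbauer nu n) := by
  cases n with
  | zero =>
    have : gegenbauer nu 0 = fun _ => 1 := by ext y; exact geg_zero nu y
    rw [this]; exact continuous_const
  | succ n => exact continuous_iff_continuousAt.2 fun x => (geg_deriv nu n x).continuousAt

/-- `(λ)_n / n!`. -/
def gegA (lam : ℝ) (n : ℕ) : ℝ := ∏ i ∈ Finset.range n, ((lam + i) / (i + 1))

lemma gegA_nonneg {lam : ℝ} (h : 0 < lam) (n : ℕ) : 0 ≤ gegA lam n :=
  Finset.prod_nonneg fun i _ => by positivity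

lemma gegA_succ (lam : ℝ) (n : ℕ) : ((n : ℝ) + 1) * gegA lam (n + 1) = (lam + n) * gegA lam n := by
  have : (n : ℝ) + 1 ≠ 0 := by positivity
  rw [gegA, Finset.prod_range_succ, ← gegA]
  field_simp

open PowerSeries in
/-- power series of `(1 - zX)^{-λ}`. -/
def gegF (lam : ℝ) (z : ℂ) : PowerSeries ℂ := PowerSeries.mk fun k => (gegA lam k : ℂ) * z ^ k

open PowerSeries in
lemma coeff_X_mul_D (H : PowerSeries ℂ) (n : ℕ) :
    coeff n (X * derivative ℂ H) = n * coeff n H := by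
  cases n with
  | zero => simp
  | succ n => rw [coeff_succ_X_mul, coeff_derivative]; push_cast; ring

open PowerSeries in
lemma gegF_D (lam : ℝ) (z : ℂ) :
    derivative ℂ (gegF lam z) = C (lam * z) * gegF lam z
      + C z * (X * derivative ℂ (gegF lam z)) := by
  ext n
  rw [map_add, coeff_C_mul, coeff_C_mul, coeff_X_mul_D, coeff_derivative]
  simp only [gegF, coeff_mk]
  have h : ((n : ℂ) + 1) * gegA lam (n + 1) = (lam + n) * gegA lam n := by
    exact_mod_cast gegA_succ lam n
  linear_combination z ^ (n + 1) * h

open PowerSeries in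
lemma geg_coeff (lam : ℝ) (x : ℝ) (z w : ℂ) (hzw : z * w = 1) (hx : z + w = 2 * x) (n : ℕ) :
    coeff n (gegF lam z * gegF lam w) = (gegenbauer lam n x : ℂ) := by
  have hz := gegF_D lam z
  have hw := gegF_D lam w
  set F := gegF lam z with hF
  set G := gegF lam w with hG
  have c1 : (C z : PowerSeries ℂ) * C w = 1 := by rw [← map_mul, hzw, map_one]
  have c2 : (C z : PowerSeries ℂ) + C w = C (2 * (x : ℂ)) := by rw [← map_add, hx]
  have key : derivative ℂ (F * G) = C (2 * (x : ℂ)) * (X * derivative ℂ (F * G))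
      - X * (X * derivative ℂ (F * G)) + C (lam : ℂ) * (C (2 * (x : ℂ)) * (F * G))
      - C (2 * lam : ℂ) * (X * (F * G)) := by
    have hm : derivative ℂ (F * G) = F * derivative ℂ G + G * derivative ℂ F := by
      simp [Derivation.leibniz]
    rw [hm, ← c2]
    simp only [map_mul] at hz hw ⊢
    have t2 : (C (2 : ℂ) : PowerSeries ℂ) = 2 := map_ofNat C 2
    rw [t2]
    linear_combination (1 - C w * X) * G * hz + (1 - C z * X) * F * hw
      - (X * X * (F * derivative ℂ G + G * derivative ℂ F) + 2 * C (lam : ℂ) * X * F * G) * c1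
  have f0 : coeff 0 (F * G) = 1 := by
    simp [hF, hG, gegF, gegA]
  induction n using Nat.twoStepInduction with
  | zero => rw [f0, geg_zero]; simp
  | one =>
    have := congrArg (coeff 0) key
    simp only [map_add, map_sub, coeff_C_mul, coeff_zero_X_mul, coeff_derivative, f0] at this
    rw [geg_one]
    simp at this ⊢
    linear_combination this
  | more n h0 h1 =>
    have := congrArg (coeff (n + 1)) key
    simp only [map_add, map_sub, coeff_C_mul, coeff_succ_X_mul, coeff_X_mul_D, coeff_derivative,
      h0, h1] at this
    have r : ((n : ℂ) + 2) * gegenbauer lam (n + 2) x =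
      2 * x * ((n : ℂ) + 1 + lam) * gegenbauer lam (n + 1) x
        - ((n : ℂ) + 2 * lam) * gegenbauer lam n x := by exact_mod_cast geg_rec lam n x
    have e : (n : ℂ) + 2 ≠ 0 := by exact_mod_cast (by positivity : (n : ℝ) + 2 ≠ 0)
    apply mul_left_cancel₀ e
    push_cast at this
    linear_combination this - r

lemma geg_bound {lam : ℝ} (hl : 0 < lam) (n : ℕ) {x : ℝ} (hx : x ∈ Set.Icc (-1 : ℝ) 1) :
    |gegenbauer lam n x| ≤ gegenbauer lam n 1 := by
  have hone := geg_coeff lam 1 1 1 (by norm_num) (by norm_num) n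
  set z : ℂ := Complex.exp (Real.arccos x * Complex.I) with hz
  set w : ℂ := Complex.exp (-(Real.arccos x * Complex.I)) with hw
  have hzn : ‖z‖ = 1 := Complex.norm_exp_ofReal_mul_I _
  have hzw : z * w = 1 := by rw [hz, hw, ← Complex.exp_add]; simp
  have hwn : ‖w‖ = 1 := by
    have := congrArg norm hzw
    rw [norm_mul, hzn] at this
    simpa using this
  have hs : z + w = 2 * x := by
    have h1 : Complex.cos (Real.arccos x) = x := by
      rw [← Complex.ofReal_cos, Real.cos_arccos hx.1 hx.2]
    rw [← h1, Complex.cos, hz, hw, neg_mul]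
    ring
  have hc := geg_coeff lam x z w hzw hs n
  rw [PowerSeries.coeff_mul] at hone hc
  simp only [gegF, PowerSeries.coeff_mk, one_pow, mul_one] at hone hc
  have h1 : gegenbauer lam n 1 = ∑ p ∈ Finset.HasAntidiagonal.antidiagonal n, gegA lam p.1 * gegA lam p.2 := by
    have := hone.symm
    exact_mod_cast this
  rw [h1, ← Real.norm_eq_abs, ← Complex.norm_real, ← hc]
  refine (norm_sum_le _ _).trans (Finset.sum_le_sum fun p _ => ?_)
  simp [norm_mul, norm_pow, hzn, hwn, abs_of_nonneg (gegA_nonneg hl _)]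

lemma geg_one_nonneg {lam : ℝ} (hl : 0 < lam) (n : ℕ) : 0 ≤ gegenbauer lam n 1 :=
  (abs_nonneg _).trans (geg_bound hl n (x := 1) (by norm_num))

lemma geg_step {nu : ℝ} (hn : 0 < nu) (n : ℕ) :
    gegenbauer nu (n + 1) 1 ≤ 2 * nu * gegenbauer (nu + 1) n 1 := by
  cases n with
  | zero => simp [geg_zero, geg_one]
  | succ n =>
    have a := geg_relA nu n 1
    have q0 := geg_one_nonneg (lam := nu + 1) (by linarith) n
    have q1 := geg_one_nonneg (lam := nu + 1) (by linarith) (n + 1)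
    have e : 0 < (n : ℝ) + 2 := by positivity
    refine le_of_mul_le_mul_left ?_ e
    rw [a]
    have : 0 ≤ nu * gegenbauer (nu + 1) n 1 := by positivity
    have : 0 ≤ (n + 1) * (nu * gegenbauer (nu + 1) (n + 1) 1) := by positivity
    nlinarith

lemma radPD_zero_nonneg {k : ℕ} {f : ℝ → ℝ} (h : radPD k f) : 0 ≤ f 0 := by
  have := h.2 1 (fun _ => 0) (fun _ => 1)
  simpa using this

lemma radPD_bound {k : ℕ} (hk : 1 ≤ k) {f : ℝ → ℝ} (h : radPD k f) {t : ℝ} (ht : 0 ≤ t) :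
    |f t| ≤ f 0 := by
  let e : EuclideanSpace ℝ (Fin k) := EuclideanSpace.single ⟨0, hk⟩ t
  have hd : dist e 0 = t := by simp [e, abs_of_nonneg ht]
  have hd' : dist 0 e = t := by rw [dist_comm, hd]
  have h1 := h.2 2 ![e, 0] ![1, 1]
  have h2 := h.2 2 ![e, 0] ![1, -1]
  simp only [Fin.sum_univ_two, Matrix.cons_val_zero, Matrix.cons_val_one, dist_self, hd, hd'] at h1 h2
  rw [abs_le]
  constructor <;> linarith

lemma radPD_tsum {k : ℕ} (hk : 1 ≤ k) {f : ℕ → ℝ → ℝ} (h : ∀ n, radPD k (f n)) {c : ℕ → ℝ}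
    (hc : ∀ n, 0 ≤ c n) (hs : Summable fun n => f n 0 * c n) :
    (∀ t, 0 ≤ t → Summable fun n => f n t * c n) ∧ radPD k (fun t => ∑' n, f n t * c n) := by
  have hb : ∀ n t, 0 ≤ t → ‖f n t * c n‖ ≤ f n 0 * c n := fun n t ht => by
    rw [norm_mul, Real.norm_eq_abs, Real.norm_eq_abs, abs_of_nonneg (hc n)]
    exact mul_le_mul_of_nonneg_right (radPD_bound hk (h n) ht) (hc n)
  have hS : ∀ t, 0 ≤ t → Summable fun n => f n t * c n := fun t ht =>
    Summable.of_norm_bounded hs fun n => hb n t ht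
  refine ⟨hS, ?_, ?_⟩
  · exact continuousOn_tsum (fun n => (h n).1.mul continuousOn_const) hs
      fun n t ht => hb n t ht
  · intro N x a
    have hh : HasSum (fun n => ∑ i, ∑ j, a i * (f n (dist (x i) (x j)) * c n) * a j)
        (∑ i, ∑ j, a i * (∑' n, f n (dist (x i) (x j)) * c n) * a j) :=
      hasSum_sum fun i _ => hasSum_sum fun j _ =>
        (((hS _ dist_nonneg).hasSum).mul_left (a i)).mul_right (a j)
    refine hh.nonneg fun n => ?_
    have := mul_nonneg ((h n).2 N x a) (hc n)
    rw [Finset.sum_mul] at this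
    refine this.trans_eq (Finset.sum_congr rfl fun i _ => ?_)
    rw [Finset.sum_mul]
    exact Finset.sum_congr rfl fun j _ => by ring

lemma radPD_mul {k : ℕ} {f : ℝ → ℝ} (h : radPD k f) {c : ℝ} (hc : 0 ≤ c) :
    radPD k (fun t => f t * c) := by
  refine ⟨h.1.mul continuousOn_const, fun N x a => ?_⟩
  have := mul_nonneg (h.2 N x a) hc
  rw [Finset.sum_mul] at this
  refine this.trans_eq (Finset.sum_congr rfl fun i _ => ?_)
  rw [Finset.sum_mul]
  exact Finset.sum_congr rfl fun j _ => by ring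

lemma hasSum_int {h : ℕ → ℝ → ℝ} (hc : ∀ n, Continuous (h n)) {b : ℕ → ℝ} (hb : Summable b)
    (hbd : ∀ n, ∀ w ∈ Set.Icc (-1 : ℝ) 1, |h n w| ≤ b n) {x : ℝ} (hx : x ∈ Set.Icc (-1 : ℝ) 1) :
    HasSum (fun n => ∫ w in (-1 : ℝ)..x, h n w) (∫ w in (-1 : ℝ)..x, ∑' n, h n w) := by
  have hsub : ∀ w ∈ Set.uIoc (-1 : ℝ) x, w ∈ Set.Icc (-1 : ℝ) 1 := fun w hw => by
    rw [Set.uIoc_of_le hx.1] at hw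
    exact ⟨hw.1.le, hw.2.trans hx.2⟩
  refine intervalIntegral.hasSum_integral_of_dominated_convergence (fun n _ => b n)
    (fun n => (hc n).aestronglyMeasurable) ?_ ?_ ?_ ?_
  · exact fun n => ae_of_all _ fun w hw => hbd n w (hsub w hw)
  · exact ae_of_all _ fun w hw => hb
  · exact intervalIntegrable_const
  · exact ae_of_all _ fun w hw =>
      (Summable.of_norm_bounded hb fun n => hbd n w (hsub w hw)).hasSum

lemma hasSum_int2 {h : ℕ → ℝ → ℝ} (hc : ∀ n, Continuous (h n)) {b : ℕ → ℝ} (hb : Summable b)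
    (hbd : ∀ n, ∀ w ∈ Set.Icc (-1 : ℝ) 1, |h n w| ≤ b n) {x : ℝ} (hx : x ∈ Set.Icc (-1 : ℝ) 1) :
    HasSum (fun n => ∫ u in (-1 : ℝ)..x, ∫ w in (-1 : ℝ)..u, h n w)
      (∫ u in (-1 : ℝ)..x, ∫ w in (-1 : ℝ)..u, ∑' n, h n w) := by
  have e : (∫ u in (-1 : ℝ)..x, ∫ w in (-1 : ℝ)..u, ∑' n, h n w)
      = ∫ u in (-1 : ℝ)..x, ∑' n, ∫ w in (-1 : ℝ)..u, h n w := by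
    refine intervalIntegral.integral_congr fun u hu => ?_
    rw [Set.uIcc_of_le hx.1] at hu
    exact (hasSum_int hc hb hbd ⟨hu.1, hu.2.trans hx.2⟩).tsum_eq.symm
  rw [e]
  refine hasSum_int (b := fun n => b n * 2) (fun n => ?_) (hb.mul_right 2) (fun n u hu => ?_) hx
  · exact intervalIntegral.continuous_primitive (fun a b => (hc n).intervalIntegrable a b) _
  · have hb0 : 0 ≤ b n := (abs_nonneg _).trans (hbd n 0 (by norm_num))
    have := intervalIntegral.norm_integral_le_of_norm_le_const (a := -1) (b := u) (f := h n)
      (C := b n) (fun w hw => by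
        rw [Set.uIoc_of_le hu.1] at hw
        exact hbd n w ⟨hw.1.le, hw.2.trans hu.2⟩)
    rw [Real.norm_eq_abs] at this
    refine this.trans (mul_le_mul_of_nonneg_left ?_ hb0)
    rw [abs_of_nonneg (by linarith [hu.1])]
    linarith [hu.2]

lemma geg_int {nu : ℝ} (hn : 0 < nu) (n : ℕ) (u : ℝ) :
    (∫ w in (-1 : ℝ)..u, gegenbauer (nu + 1) n w)
      = (gegenbauer nu (n + 1) u - gegenbauer nu (n + 1) (-1)) / (2 * nu) := by
  have := intervalIntegral.integral_eq_sub_of_hasDerivAt (a := -1) (b := u)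
    (fun x _ => geg_deriv nu n x)
    ((continuous_const.mul (geg_cont (nu + 1) n)).intervalIntegrable _ _)
  rw [intervalIntegral.integral_const_mul] at this
  rw [← this]
  field_simp

lemma geg_int2 {mu : ℝ} (hm : 0 < mu) (n : ℕ) (hn : Even n) (x : ℝ) :
    (∫ u in (-1 : ℝ)..x, ∫ w in (-1 : ℝ)..u, gegenbauer (mu + 1 + 1) n w)
      = (gegenbauer mu (n + 2) x - gegenbauer mu (n + 2) 1) / (4 * mu * (mu + 1))
        + gegenbauer (mu + 1) (n + 1) 1 / (2 * (mu + 1)) * (x + 1) := by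
  have hm1 : 0 < mu + 1 := by linarith
  simp only [geg_int hm1]
  rw [intervalIntegral.integral_div, intervalIntegral.integral_sub
    ((geg_cont _ _).intervalIntegrable _ _) intervalIntegrable_const, geg_int hm,
    intervalIntegral.integral_const, geg_neg, geg_neg, hn.add_one.neg_one_pow,
    (hn.add_one.add_one).neg_one_pow]
  simp only [smul_eq_mul]
  field_simp
  ring

end Helpers

theorem montee_I1_sq (d k : ℕ) (hd : 6 ≤ d) (hk : 1 ≤ k) (f : ℕ → ℝ → ℝ)
    (hpd : ∀ n, radPD k (f n))
    (hsum : Summable fun n => f n 0 * gegenbauer (((d : ℝ) - 1) / 2) n 1)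
    (hodd : ∀ n, f (2 * n + 1) = 0) :
    ∃ g : ℕ → ℝ → ℝ,
      (∀ n, radPD k (g n)) ∧
      (∀ x ∈ Set.Icc (-1 : ℝ) 1, ∀ t, 0 ≤ t →
        (∫ u in (-1 : ℝ)..x, ∫ w in (-1 : ℝ)..u,
            ∑' n, f n t * gegenbauer (((d : ℝ) - 1) / 2) n w)
          = ∑' n, g n t * gegenbauer (((d : ℝ) - 5) / 2) n x) ∧
      memPSphereRk (d - 4) k (fun x t =>
        ∫ u in (-1 : ℝ)..x, ∫ w in (-1 : ℝ)..u,
          ∑' n, f n t * gegenbauer (((d : ℝ) - 1) / 2) n w) := by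
  obtain ⟨mu, hmu⟩ : ∃ mu : ℝ, mu = ((d : ℝ) - 5) / 2 := ⟨_, rfl⟩
  have hd' : (6 : ℝ) ≤ d := by exact_mod_cast hd
  have hm : 0 < mu := by rw [hmu]; linarith
  have hm1 : 0 < mu + 1 := by linarith
  have hm2 : 0 < mu + 1 + 1 := by linarith
  have e1 : ((d : ℝ) - 1) / 2 = mu + 1 + 1 := by rw [hmu]; ring
  have e2 : (((d - 4 : ℕ) : ℝ) - 1) / 2 = mu := by
    rw [hmu, Nat.cast_sub (by omega)]; push_cast; ring
  unfold memPSphereRk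
  rw [e2]
  rw [← hmu]
  rw [e1] at hsum ⊢
  -- coefficients
  let K : ℝ := 4 * mu * (mu + 1)
  have hK : 0 < K := by positivity
  let c0 : ℕ → ℝ := fun n =>
    (2 * mu * gegenbauer (mu + 1) (n + 1) 1 - gegenbauer mu (n + 2) 1) / K
  let c1 : ℕ → ℝ := fun n => gegenbauer (mu + 1) (n + 1) 1 / K
  let Q : ℕ → ℝ := fun n => gegenbauer (mu + 1 + 1) n 1
  have p1 : ∀ n, gegenbauer (mu + 1) (n + 1) 1 ≤ 2 * (mu + 1) * Q n := fun n => geg_step hm1 n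
  have p1' : ∀ n, 0 ≤ gegenbauer (mu + 1) (n + 1) 1 := fun n => geg_one_nonneg hm1 _
  have p2 : ∀ n, gegenbauer mu (n + 2) 1 ≤ 2 * mu * gegenbauer (mu + 1) (n + 1) 1 :=
    fun n => geg_step hm (n + 1)
  have p2' : ∀ n, 0 ≤ gegenbauer mu (n + 2) 1 := fun n => geg_one_nonneg hm _
  have p3 : ∀ n, 2 * mu * gegenbauer (mu + 1) (n + 1) 1 ≤ K * Q n := fun n => by
    have := mul_le_mul_of_nonneg_left (p1 n) (by positivity : 0 ≤ 2 * mu)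
    refine this.trans_eq ?_
    simp only [K]; ring
  have hc0 : ∀ n, 0 ≤ c0 n := fun n => div_nonneg (sub_nonneg.2 (p2 n)) hK.le
  have hc1 : ∀ n, 0 ≤ c1 n := fun n => div_nonneg (p1' n) hK.le
  have f0 : ∀ n, 0 ≤ f n 0 := fun n => radPD_zero_nonneg (hpd n)
  have s0 : Summable fun n => f n 0 * c0 n := by
    refine Summable.of_nonneg_of_le (fun n => mul_nonneg (f0 n) (hc0 n)) (fun n => ?_) hsum
    refine mul_le_mul_of_nonneg_left ?_ (f0 n)
    simp only [c0]
    rw [div_le_iff₀ hK]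
    have := p3 n
    have := p2' n
    simp only [Q] at *
    linarith
  have s1 : Summable fun n => f n 0 * c1 n := by
    refine Summable.of_nonneg_of_le (fun n => mul_nonneg (f0 n) (hc1 n)) (fun n => ?_)
      (hsum.mul_right (1 / (2 * mu)))
    rw [mul_assoc]
    refine mul_le_mul_of_nonneg_left ?_ (f0 n)
    simp only [c1]
    rw [div_le_iff₀ hK]
    have := p3 n
    simp only [Q] at *
    field_simp
    linarith
  have s2 : ∀ t, 0 ≤ t → ∀ x ∈ Set.Icc (-1 : ℝ) 1,
      Summable fun n => f n t * (1 / K) * gegenbauer mu (n + 2) x := by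
    intro t ht x hx
    refine Summable.of_norm_bounded hsum fun n => ?_
    rw [norm_mul, norm_mul, Real.norm_eq_abs, Real.norm_eq_abs, Real.norm_eq_abs,
      abs_of_pos (by positivity : 0 < 1 / K), mul_assoc]
    refine mul_le_mul (radPD_bound hk (hpd n) ht) ?_ (by positivity) (f0 n)
    rw [one_div_mul_eq_div, div_le_iff₀ hK]
    have := p3 n
    have := p2 n
    have := geg_bound hm (n + 2) hx
    simp only [Q] at *
    linarith
  obtain ⟨S0, P0⟩ := radPD_tsum hk hpd hc0 s0
  obtain ⟨S1, P1⟩ := radPD_tsum hk hpd hc1 s1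
  let g : ℕ → ℝ → ℝ := fun n => match n with
    | 0 => fun t => ∑' n, f n t * c0 n
    | 1 => fun t => ∑' n, f n t * c1 n
    | (n + 2) => fun t => f n t * (1 / K)
  have hg : ∀ n, radPD k (g n) := by
    intro n
    match n with
    | 0 => exact P0
    | 1 => exact P1
    | (n + 2) => exact radPD_mul (hpd n) (by positivity)
  have hgs : ∀ t, 0 ≤ t → ∀ x ∈ Set.Icc (-1 : ℝ) 1,
      Summable fun n => g n t * gegenbauer mu n x := fun t ht x hx =>
    (summable_nat_add_iff 2).1 (s2 t ht x hx)
  have main : ∀ x ∈ Set.Icc (-1 : ℝ) 1, ∀ t, 0 ≤ t →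
      (∫ u in (-1 : ℝ)..x, ∫ w in (-1 : ℝ)..u,
            ∑' n, f n t * gegenbauer (mu + 1 + 1) n w)
          = ∑' n, g n t * gegenbauer mu n x := by
    intro x hx t ht
    have A := hasSum_int2 (h := fun n w => f n t * gegenbauer (mu + 1 + 1) n w)
      (fun n => continuous_const.mul (geg_cont _ _)) hsum (fun n w hw => by
        rw [abs_mul]
        exact mul_le_mul (radPD_bound hk (hpd n) ht) (geg_bound hm2 n hw) (abs_nonneg _) (f0 n)) hx
    have B := ((S0 t ht).hasSum.add ((S1 t ht).hasSum.mul_right (gegenbauer mu 1 x))).add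
      (s2 t ht x hx).hasSum
    have E : (fun n => ∫ u in (-1 : ℝ)..x, ∫ w in (-1 : ℝ)..u,
          f n t * gegenbauer (mu + 1 + 1) n w)
        = fun n => f n t * c0 n + f n t * c1 n * gegenbauer mu 1 x
          + f n t * (1 / K) * gegenbauer mu (n + 2) x := by
      ext n
      rcases Nat.even_or_odd n with hn | ⟨m, rfl⟩
      · simp only [intervalIntegral.integral_const_mul]
        rw [geg_int2 hm n hn, geg_one]
        simp only [c0, c1, K]
        field_simp
        ring
      · simp [hodd m]
    rw [E] at A
    rw [A.unique B, ← (hgs t ht x hx).sum_add_tsum_nat_add 2]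
    simp [Finset.sum_range_succ, g, geg_zero]
  exact ⟨g, hg, main, g, hg, hgs 0 le_rfl 1 (by norm_num), main⟩
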